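/- For every finite no-signalling model satisfying the uniform-settings condition that is factorizable (p λ j k = pA λ j · pB λ k with pA λ, pB λ probability vectors on Fin 2) and has free-will parameter at most P where 1/4 ≤ P < 1/2, the average guessing probability G is bounded in terms of the CHSH value S by G ≤ (1/2)·(1 + (4 − S)/(4·(1 − 2P))). -/

import Mathlib

open Finset

/-- Alice's marginal outcome distribution (computed with Bob's setting `k = 0`;
by no-signalling it is independent of `k`). -/
noncomputable def margA {Λ : Type} (q : Λ → Fin 2 → Fin 2 → Fin 2 → Fin 2 → ℝ)
    (l : Λ) (j a : Fin 2) : ℝ := ∑ b, q l j 0 a b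

/-- Bob's marginal outcome distribution (computed with Alice's setting `j = 0`;
by no-signalling it is independent of `j`). -/
noncomputable def margB {Λ : Type} (q : Λ → Fin 2 → Fin 2 → Fin 2 → Fin 2 → ℝ)
    (l : Λ) (k b : Fin 2) : ℝ := ∑ a, q l 0 k a b

/-- Local guessing probability `G(λ)`: the maximum of all eight marginal probabilities. -/
noncomputable def Gloc {Λ : Type} (q : Λ → Fin 2 → Fin 2 → Fin 2 → Fin 2 → ℝ)
    (l : Λ) : ℝ :=
  max
    (max (max (margA q l 0 0) (margA q l 0 1)) (max (margA q l 1 0) (margA q l 1 1)))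
    (max (max (margB q l 0 0) (margB q l 0 1)) (max (margB q l 1 0) (margB q l 1 1)))

/-- Average guessing probability `G = Σ_λ ρ(λ) G(λ)`. -/
noncomputable def Gavg {Λ : Type} [Fintype Λ] (ρ : Λ → ℝ)
    (q : Λ → Fin 2 → Fin 2 → Fin 2 → Fin 2 → ℝ) : ℝ := ∑ l, ρ l * Gloc q l

/-- Observed distribution `p̃(a,b|A_j,B_k) = 4 Σ_λ ρ(λ) p(A_j,B_k|λ) q(a,b|A_j,B_k,λ)`. -/
noncomputable def ptilde {Λ : Type} [Fintype Λ] (ρ : Λ → ℝ)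
    (p : Λ → Fin 2 → Fin 2 → ℝ) (q : Λ → Fin 2 → Fin 2 → Fin 2 → Fin 2 → ℝ)
    (a b j k : Fin 2) : ℝ := 4 * ∑ l, ρ l * p l j k * q l j k a b

/-- CHSH value `S = |Σ_{a,b,j,k} (-1)^(a+b+jk) p̃(a,b|A_j,B_k)|`. -/
noncomputable def chsh {Λ : Type} [Fintype Λ] (ρ : Λ → ℝ)
    (p : Λ → Fin 2 → Fin 2 → ℝ) (q : Λ → Fin 2 → Fin 2 → Fin 2 → Fin 2 → ℝ) : ℝ :=
  |∑ a : Fin 2, ∑ b : Fin 2, ∑ j : Fin 2, ∑ k : Fin 2,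
      (-1 : ℝ) ^ ((a : ℕ) + (b : ℕ) + (j : ℕ) * (k : ℕ)) * ptilde ρ p q a b j k|

/-- A finite no-signalling model: `ρ` is a probability distribution on `Λ`, each
`p λ` is a probability distribution on settings, each `q λ j k` is a probability
distribution on outcomes, and the marginals satisfy no-signalling. -/
def IsModel {Λ : Type} [Fintype Λ] (ρ : Λ → ℝ) (p : Λ → Fin 2 → Fin 2 → ℝ)
    (q : Λ → Fin 2 → Fin 2 → Fin 2 → Fin 2 → ℝ) : Prop :=
  (∀ l, 0 ≤ ρ l) ∧ (∑ l, ρ l = 1) ∧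
  (∀ l j k, 0 ≤ p l j k) ∧ (∀ l, ∑ j, ∑ k, p l j k = 1) ∧
  (∀ l j k a b, 0 ≤ q l j k a b) ∧ (∀ l j k, ∑ a, ∑ b, q l j k a b = 1) ∧
  (∀ l j k a, ∑ b, q l j k a b = margA q l j a) ∧
  (∀ l j k b, ∑ a, q l j k a b = margB q l k b)

/-- Uniform-settings condition: `Σ_λ ρ(λ) p(A_j,B_k|λ) = 1/4` for all `j,k`. -/
def UniformSettings {Λ : Type} [Fintype Λ] (ρ : Λ → ℝ)
    (p : Λ → Fin 2 → Fin 2 → ℝ) : Prop := ∀ j k, ∑ l, ρ l * p l j k = 1 / 4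

/-- The model has free-will parameter at most `P`. -/
def FreeWillLE {Λ : Type} (ρ : Λ → ℝ) (p : Λ → Fin 2 → Fin 2 → ℝ) (P : ℝ) : Prop :=
  ∀ l, 0 < ρ l → ∀ j k, p l j k ≤ P

/-- Correlator `E(A_j,B_k|λ)` of the outcomes, with values `(-1)^a` and `(-1)^b`. -/
noncomputable def correlator {Λ : Type} (q : Λ → Fin 2 → Fin 2 → Fin 2 → Fin 2 → ℝ)
    (l : Λ) (j k : Fin 2) : ℝ := q l j k 0 0 - q l j k 0 1 - q l j k 1 0 + q l j k 1 1

/-- If three of the four products of the entries of two vectors summing to one are at most `P`,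
then the remaining product is at least `1 / 2 - P`. -/
lemma half_sub_le_mul {P x x' y y' : ℝ} (hx : x + x' = 1) (hy : y + y' = 1)
    (h₁ : x * y' ≤ P) (h₂ : x' * y ≤ P) (h₃ : x' * y' ≤ P) (hP : 1 / 4 ≤ P) :
    1 / 2 - P ≤ x * y := by
  obtain rfl : x' = 1 - x := by linarith
  obtain rfl : y' = 1 - y := by linarith
  rcases le_total x (1 / 2) with hx2 | hx2 <;> rcases le_total y (1 / 2) with hy2 | hy2 <;>
  nlinarith [mul_nonneg (sub_nonneg.2 hx2) (sub_nonneg.2 hy2)]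

lemma abs_correlator_le_one {Λ : Type} [Fintype Λ] {ρ : Λ → ℝ} {p : Λ → Fin 2 → Fin 2 → ℝ}
    {q : Λ → Fin 2 → Fin 2 → Fin 2 → Fin 2 → ℝ} (h : IsModel ρ p q) (l : Λ) (j k : Fin 2) :
    |correlator q l j k| ≤ 1 := by
  obtain ⟨-, -, -, -, h0, h1, -, -⟩ := h
  have h1 := h1 l j k
  simp only [Fin.sum_univ_two] at h1
  rw [correlator, abs_le]
  constructor <;> linarith [h0 l j k 0 0, h0 l j k 0 1, h0 l j k 1 0, h0 l j k 1 1]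

lemma four_mul_Gloc_add_abs_le {Λ : Type} [Fintype Λ] {ρ : Λ → ℝ} {p : Λ → Fin 2 → Fin 2 → ℝ}
    {q : Λ → Fin 2 → Fin 2 → Fin 2 → Fin 2 → ℝ} (h : IsModel ρ p q) (l : Λ) :
    4 * Gloc q l + |correlator q l 0 0 + correlator q l 0 1 + correlator q l 1 0
      - correlator q l 1 1| ≤ 6 := by
  obtain ⟨-, -, -, -, h0, h1, hA, hB⟩ := h
  have h1 := h1 l
  have h0 := h0 l
  have hA := hA l
  have hB := hB l
  simp only [Fin.forall_fin_two, Fin.sum_univ_two] at h0 h1 hA hB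
  suffices Gloc q l ≤ (6 - |correlator q l 0 0 + correlator q l 0 1 + correlator q l 1 0
      - correlator q l 1 1|) / 4 by linarith
  simp only [Gloc, max_le_iff, correlator]
  rcases abs_cases (q l 0 0 0 0 - q l 0 0 0 1 - q l 0 0 1 0 + q l 0 0 1 1
    + (q l 0 1 0 0 - q l 0 1 0 1 - q l 0 1 1 0 + q l 0 1 1 1)
    + (q l 1 0 0 0 - q l 1 0 0 1 - q l 1 0 1 0 + q l 1 0 1 1)
    - (q l 1 1 0 0 - q l 1 1 0 1 - q l 1 1 1 0 + q l 1 1 1 1)) with ⟨he, -⟩ | ⟨he, -⟩ <;>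
  rw [he] <;> refine ⟨⟨⟨?_, ?_⟩, ?_, ?_⟩, ⟨?_, ?_⟩, ?_, ?_⟩ <;> linarith

lemma chsh_eq {Λ : Type} [Fintype Λ] (ρ : Λ → ℝ) (p : Λ → Fin 2 → Fin 2 → ℝ)
    (q : Λ → Fin 2 → Fin 2 → Fin 2 → Fin 2 → ℝ) :
    chsh ρ p q = |∑ l, ρ l * (4 * (p l 0 0 * correlator q l 0 0 + p l 0 1 * correlator q l 0 1
      + p l 1 0 * correlator q l 1 0 - p l 1 1 * correlator q l 1 1))| := by
  unfold chsh ptilde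
  congr 1
  simp only [Finset.mul_sum, ← Finset.sum_add_distrib, Fin.sum_univ_two]
  refine Finset.sum_congr rfl fun l _ => ?_
  simp only [correlator, Fin.val_zero, Fin.val_one]
  ring

/-- A weighted CHSH combination loses, relative to its maximum `∑ w = 1`, at least `c` times what
the unweighted combination loses relative to `4`, if all weights are at least `c`. -/
lemma abs_weighted_chsh_le {c w₁ w₂ w₃ w₄ e₁ e₂ e₃ e₄ : ℝ} (hw : w₁ + w₂ + w₃ + w₄ = 1)
    (h₁ : c ≤ w₁) (h₂ : c ≤ w₂) (h₃ : c ≤ w₃) (h₄ : c ≤ w₄) (hc : 0 ≤ c)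
    (he₁ : |e₁| ≤ 1) (he₂ : |e₂| ≤ 1) (he₃ : |e₃| ≤ 1) (he₄ : |e₄| ≤ 1) :
    |w₁ * e₁ + w₂ * e₂ + w₃ * e₃ - w₄ * e₄| ≤ 1 - c * (4 - |e₁ + e₂ + e₃ - e₄|) := by
  rw [abs_le] at he₁ he₂ he₃ he₄
  have key (w e : ℝ) (h : c ≤ w) (he : -1 ≤ e ∧ e ≤ 1) :
      w * e ≤ w - c * (1 - e) ∧ -(w * e) ≤ w - c * (1 + e) := by
    constructor <;> nlinarith
  have k₁ := key _ _ h₁ he₁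
  have k₂ := key _ _ h₂ he₂
  have k₃ := key _ _ h₃ he₃
  have k₄ := key _ _ h₄ he₄
  have b₁ := mul_le_mul_of_nonneg_left (le_abs_self (e₁ + e₂ + e₃ - e₄)) hc
  have b₂ := mul_le_mul_of_nonneg_left (neg_le_abs (e₁ + e₂ + e₃ - e₄)) hc
  rw [abs_le]
  constructor <;> linarith

/-- for every factorizable finite no-signalling model with uniform
settings and free-will parameter at most `P`, `1/4 ≤ P < 1/2`, the average guessing
probability is bounded by `G ≤ (1/2)(1 + (4-S)/(4(1-2P)))`. -/
theorem guessing_le_of_chsh_factorizable {Λ : Type} [Fintype Λ] (ρ : Λ → ℝ)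
    (p : Λ → Fin 2 → Fin 2 → ℝ) (q : Λ → Fin 2 → Fin 2 → Fin 2 → Fin 2 → ℝ)
    (pA pB : Λ → Fin 2 → ℝ) (P : ℝ)
    (hmodel : IsModel ρ p q) (hunif : UniformSettings ρ p)
    (hfac : ∀ l j k, p l j k = pA l j * pB l k)
    (hpA0 : ∀ l j, 0 ≤ pA l j) (hpA1 : ∀ l, ∑ j, pA l j = 1)
    (hpB0 : ∀ l k, 0 ≤ pB l k) (hpB1 : ∀ l, ∑ k, pB l k = 1)
    (hfw : FreeWillLE ρ p P) (hP : 1 / 4 ≤ P) (hP' : P < 1 / 2) :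
    Gavg ρ q ≤ (1 / 2) * (1 + (4 - chsh ρ p q) / (4 * (1 - 2 * P))) := by
  have hG (l : Λ) : ρ l * |4 * (p l 0 0 * correlator q l 0 0 + p l 0 1 * correlator q l 0 1
      + p l 1 0 * correlator q l 1 0 - p l 1 1 * correlator q l 1 1)|
      ≤ ρ l * (4 - 4 * (1 - 2 * P) * (2 * Gloc q l - 1)) := by
    rcases (hmodel.1 l).eq_or_lt with h0 | h0
    · simp [← h0]
    refine mul_le_mul_of_nonneg_left ?_ h0.le
    have hle := hfw l h0
    have hA := hpA1 l
    have hB := hpB1 l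
    have hs := hmodel.2.2.2.1 l
    simp only [Fin.sum_univ_two] at hA hB hs
    simp only [hfac, Fin.forall_fin_two] at hle
    obtain ⟨⟨l₁, l₂⟩, l₃, l₄⟩ := hle
    have hA' := (add_comm _ _).trans hA
    have hB' := (add_comm _ _).trans hB
    have hE := abs_correlator_le_one hmodel l
    have hW := abs_weighted_chsh_le (c := 1 / 2 - P)
      (w₁ := p l 0 0) (w₂ := p l 0 1) (w₃ := p l 1 0) (w₄ := p l 1 1) (by linarith)
      (hfac l 0 0 ▸ half_sub_le_mul hA hB l₂ l₃ l₄ hP)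
      (hfac l 0 1 ▸ half_sub_le_mul hA hB' l₁ l₄ l₃ hP)
      (hfac l 1 0 ▸ half_sub_le_mul hA' hB l₄ l₁ l₂ hP)
      (hfac l 1 1 ▸ half_sub_le_mul hA' hB' l₃ l₂ l₁ hP)
      (by linarith) (hE 0 0) (hE 0 1) (hE 1 0) (hE 1 1)
    have hb := mul_le_mul_of_nonneg_left (four_mul_Gloc_add_abs_le hmodel l)
      (show 0 ≤ 1 / 2 - P by linarith)
    rw [abs_mul, abs_of_pos (four_pos : (0 : ℝ) < 4)]
    linarith
  have hS : chsh ρ p q ≤ 4 - 4 * (1 - 2 * P) * (2 * Gavg ρ q - 1) := by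
    calc chsh ρ p q ≤ ∑ l, ρ l * (4 - 4 * (1 - 2 * P) * (2 * Gloc q l - 1)) := by
          rw [chsh_eq]
          refine (Finset.abs_sum_le_sum_abs _ _).trans (Finset.sum_le_sum fun l _ => ?_)
          rw [abs_mul, abs_of_nonneg (hmodel.1 l)]
          exact hG l
      _ = (4 + 4 * (1 - 2 * P)) * ∑ l, ρ l - 8 * (1 - 2 * P) * Gavg ρ q := by
          rw [Gavg, Finset.mul_sum, Finset.mul_sum, ← Finset.sum_sub_distrib]
          exact Finset.sum_congr rfl fun l _ => by ring
      _ = 4 - 4 * (1 - 2 * P) * (2 * Gavg ρ q - 1) := by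
          rw [hmodel.2.1]
          ring
  have hpos : 0 < 4 * (1 - 2 * P) := by linarith
  have hdiv : 2 * Gavg ρ q - 1 ≤ (4 - chsh ρ p q) / (4 * (1 - 2 * P)) := by
    rw [le_div_iff₀ hpos]
    linarith
  linarith
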